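/- The congruence lattice of a finite modular lattice is Boolean: if L is a finite modular lattice, then for every congruence α of L there exists a congruence β of L such that α ∩ β is the equality relation on L and the least congruence containing α ∪ β is the total relation on L. -/

import Mathlib

/-- A congruence of a lattice `L`: an equivalence relation compatible with `⊓` and `⊔`. -/
def IsLatCongr {L : Type*} [Lattice L] (r : L → L → Prop) : Prop :=
  Equivalence r ∧
    ∀ x y u v : L, r x y → r u v → r (x ⊓ u) (y ⊓ v) ∧ r (x ⊔ u) (y ⊔ v)

section TrivialOn

variable {L : Type*} [Lattice L] {α : L → L → Prop}

/-- The relation `r` is trivial on the interval `[a, b]`. -/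
def TrivialOnIcc (r : L → L → Prop) (a b : L) : Prop :=
  ∀ p q : L, a ≤ p → p ≤ q → q ≤ b → r p q → p = q

theorem TrivialOnIcc.mono {a b c d : L} (h : TrivialOnIcc α a b) (hac : a ≤ c) (hdb : d ≤ b) :
    TrivialOnIcc α c d :=
  fun p q hp hpq hq hr => h p q (hac.trans hp) hpq (hq.trans hdb) hr

theorem IsLatCongr.inf_right (hα : IsLatCongr α) {x y : L} (h : α x y) (u : L) :
    α (x ⊓ u) (y ⊓ u) :=
  (hα.2 x y u u h (hα.1.refl u)).1

theorem IsLatCongr.sup_right (hα : IsLatCongr α) {x y : L} (h : α x y) (u : L) :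
    α (x ⊔ u) (y ⊔ u) :=
  (hα.2 x y u u h (hα.1.refl u)).2

theorem IsLatCongr.inf_sup (hα : IsLatCongr α) {x y : L} (h : α x y) : α (x ⊓ y) (x ⊔ y) := by
  have h₁ := hα.inf_right h y
  have h₂ := hα.sup_right h y
  rw [inf_idem] at h₁
  rw [sup_idem] at h₂
  exact hα.1.trans h₁ (hα.1.symm h₂)

theorem IsLatCongr.of_inf_sup (hα : IsLatCongr α) {x y : L} (h : α (x ⊓ y) (x ⊔ y)) : α x y := by
  have hx := hα.sup_right h x
  have hy := hα.sup_right h y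
  rw [sup_eq_right.2 inf_le_left, sup_eq_left.2 le_sup_left] at hx
  rw [sup_eq_right.2 inf_le_right, sup_eq_left.2 le_sup_right] at hy
  exact hα.1.trans hx (hα.1.symm hy)

variable [IsModularLattice L]

theorem TrivialOnIcc.trans (hα : IsLatCongr α) {a b c : L} (hab : a ≤ b) (hbc : b ≤ c)
    (h₁ : TrivialOnIcc α a b) (h₂ : TrivialOnIcc α b c) : TrivialOnIcc α a c := by
  intro p q hp hpq hq hr
  have hi := h₁ (p ⊓ b) (q ⊓ b) (le_inf hp hab) (inf_le_inf_right b hpq) inf_le_right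
    (hα.inf_right hr b)
  have hs := h₂ (p ⊔ b) (q ⊔ b) le_sup_right (sup_le_sup_right hpq b) (sup_le hq hbc)
    (hα.sup_right hr b)
  exact eq_of_le_of_inf_le_of_sup_le hpq hi.ge hs.ge

theorem TrivialOnIcc.sup_right (hα : IsLatCongr α) {a b : L} (hab : a ≤ b)
    (h : TrivialOnIcc α a b) (c : L) : TrivialOnIcc α (a ⊔ c) (b ⊔ c) := by
  intro p q hp hpq hq hr
  obtain ⟨hap, hcp⟩ := sup_le_iff.1 hp
  have hi := h (p ⊓ b) (q ⊓ b) (le_inf hap hab) (inf_le_inf_right b hpq) inf_le_right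
    (hα.inf_right hr b)
  refine le_antisymm hpq ?_
  calc q ≤ (c ⊔ b) ⊓ q := le_inf (sup_comm b c ▸ hq) le_rfl
    _ ≤ c ⊔ b ⊓ q := sup_inf_le_assoc_of_le b (hcp.trans hpq)
    _ ≤ p := by
      rw [inf_comm, ← hi]
      exact sup_le hcp inf_le_left

theorem TrivialOnIcc.inf_right (hα : IsLatCongr α) {a b : L} (hab : a ≤ b)
    (h : TrivialOnIcc α a b) (c : L) : TrivialOnIcc α (a ⊓ c) (b ⊓ c) := by
  intro p q hp hpq hq hr
  obtain ⟨hqb, hqc⟩ := le_inf_iff.1 hq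
  have hs := h (p ⊔ a) (q ⊔ a) le_sup_right (sup_le_sup_right hpq a) (sup_le hqb hab)
    (hα.sup_right hr a)
  refine le_antisymm hpq ?_
  calc q ≤ (p ⊔ a) ⊓ c := le_inf (hs ▸ le_sup_left) hqc
    _ ≤ p ⊔ a ⊓ c := sup_inf_le_assoc_of_le a (hpq.trans hqc)
    _ ≤ p := sup_le le_rfl hp

/-- In a modular lattice, the pairs spanning an interval on which the congruence `α` is trivial
form a congruence. -/
theorem IsLatCongr.trivialOnIcc (hα : IsLatCongr α) :
    IsLatCongr fun x y => TrivialOnIcc α (x ⊓ y) (x ⊔ y) := by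
  have htrans : ∀ {x y z : L}, TrivialOnIcc α (x ⊓ y) (x ⊔ y) →
      TrivialOnIcc α (y ⊓ z) (y ⊔ z) → TrivialOnIcc α (x ⊓ z) (x ⊔ z) := by
    intro x y z hxy hyz
    have hlow := (hxy.mono le_rfl le_sup_right).inf_right hα inf_le_right z
    have hhigh := (hxy.mono inf_le_right le_rfl).sup_right hα le_sup_right z
    have hmid := hlow.trans hα (inf_le_inf_right z inf_le_right) (inf_le_left.trans le_sup_left) hyz
    exact (hmid.trans hα (inf_le_right.trans le_sup_right) (sup_le_sup_right le_sup_right z)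
      hhigh).mono (inf_le_inf_right z inf_le_left) (sup_le_sup_right le_sup_left z)
  have hinf : ∀ {x y : L} (u : L), TrivialOnIcc α (x ⊓ y) (x ⊔ y) →
      TrivialOnIcc α ((x ⊓ u) ⊓ (y ⊓ u)) ((x ⊓ u) ⊔ (y ⊓ u)) := by
    intro x y u h
    exact (h.inf_right hα inf_le_sup u).mono (inf_inf_distrib_right x y u).le
      (sup_le (inf_le_inf_right u le_sup_left) (inf_le_inf_right u le_sup_right))
  have hsup : ∀ {x y : L} (u : L), TrivialOnIcc α (x ⊓ y) (x ⊔ y) →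
      TrivialOnIcc α ((x ⊔ u) ⊓ (y ⊔ u)) ((x ⊔ u) ⊔ (y ⊔ u)) := by
    intro x y u h
    exact (h.sup_right hα inf_le_sup u).mono
      (le_inf (sup_le_sup_right inf_le_left u) (sup_le_sup_right inf_le_right u))
      (sup_sup_distrib_right x y u).ge
  refine ⟨⟨fun x p q hp hpq hq _ => ?_, fun {x y} h => ?_, htrans⟩, fun x y u v hxy huv => ⟨?_, ?_⟩⟩
  · rw [inf_idem] at hp
    rw [sup_idem] at hq
    exact le_antisymm hpq (hq.trans hp)
  · rwa [inf_comm, sup_comm]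
  · have h := hinf y huv
    rw [inf_comm u, inf_comm v] at h
    exact htrans (hinf u hxy) h
  · have h := hsup y huv
    rw [sup_comm u, sup_comm v] at h
    exact htrans (hsup u hxy) h

end TrivialOn

theorem TrivialOnIcc.of_covBy {L : Type*} [Lattice L] {α : L → L → Prop} {a b : L}
    (hab : a ⋖ b) (h : ¬ α a b) : TrivialOnIcc α a b := by
  intro p q hp hpq hq hr
  rcases hab.eq_or_eq hp (hpq.trans hq) with rfl | rfl
  · rcases hab.eq_or_eq hpq hq with rfl | rfl
    · rfl
    · exact absurd hr h
  · exact le_antisymm hpq hq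

theorem IsLatCongr.total_of_covBy {L : Type*} [Lattice L] [Finite L] {t : L → L → Prop}
    (ht : IsLatCongr t) (h : ∀ a b : L, a ⋖ b → t a b) (x y : L) : t x y := by
  classical
  have := Fintype.ofFinite L
  let _ : LocallyFiniteOrder L := Fintype.toLocallyFiniteOrder
  have hle : ∀ {a b : L}, a ≤ b → t a b := fun {a b} hab => by
    induction le_iff_reflTransGen_covBy.1 hab with
    | refl => exact ht.1.refl a
    | tail hac hcov ih => exact ht.1.trans (ih (le_iff_reflTransGen_covBy.2 hac)) (h _ _ hcov)
  exact ht.of_inf_sup (hle inf_le_sup)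

/-- **Corollary 3.11**: the congruence lattice of a finite modular lattice is
Boolean: every congruence `α` has a complement `β`, i.e. `α ∩ β` is equality and
the least congruence containing `α ∪ β` is the total relation. -/
theorem finite_modular_congruence_lattice_boolean {L : Type*} [Lattice L] [Fintype L]
    (hmod : ∀ x y z : L, x ≤ z → x ⊔ (y ⊓ z) = (x ⊔ y) ⊓ z)
    (α : L → L → Prop) (hα : IsLatCongr α) :
    ∃ β : L → L → Prop, IsLatCongr β ∧
      (∀ x y : L, (α x y ∧ β x y) ↔ x = y) ∧
      (∀ x y : L, ∀ t : L → L → Prop, IsLatCongr t →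
        (∀ u v : L, α u v → t u v) → (∀ u v : L, β u v → t u v) → t x y) := by
  have : IsModularLattice L := ⟨fun {x} y {z} hxz => (hmod x y z hxz).ge⟩
  refine ⟨fun x y => TrivialOnIcc α (x ⊓ y) (x ⊔ y), hα.trivialOnIcc, fun x y => ⟨?_, ?_⟩,
    fun x y t ht hαt hβt => ht.total_of_covBy (fun a b hab => ?_) x y⟩
  · rintro ⟨hxy, h⟩
    exact inf_eq_sup.1 (h _ _ le_rfl inf_le_sup le_rfl (hα.inf_sup hxy))
  · rintro rfl
    exact ⟨hα.1.refl x, hα.trivialOnIcc.1.refl x⟩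
  · by_cases h : α a b
    · exact hαt a b h
    · refine hβt a b ?_
      beta_reduce
      rw [inf_eq_left.2 hab.le, sup_eq_right.2 hab.le]
      exact .of_covBy hab h
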